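/- Fix k, n ≤ τk and encoders f_l^{(k,n)}, l = 1,…,L. Then for every ε ∈ (0,1), limsup_{m→∞} (1/m)·log₂ β(m,τ,ε) ≤ −D(P_{Y_1^n…Y_L^n V^k Z^k} ‖ Q_{Y_1^n…Y_L^n V^k Z^k})/k; in particular, limsup_{m→∞} (1/m)·log₂ β(m,τ,ε) ≤ −θ(k,τ) for every fixed k. -/

import Mathlib

open Filter Real

noncomputable section

namespace DHT

/-- Real-valued indicator of a proposition. -/
def ind (P : Prop) : ℝ := by classical exact if P then 1 else 0

/-- `p` is a probability mass function on the finite type `α`. -/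
def IsPMF {α : Type*} [Fintype α] (p : α → ℝ) : Prop :=
  (∀ a, 0 ≤ p a) ∧ ∑ a, p a = 1

/-- `f` is a stochastic kernel: every row is a pmf. -/
def IsKernel {α β : Type*} [Fintype β] (f : α → β → ℝ) : Prop :=
  ∀ a, (∀ b, 0 ≤ f a b) ∧ ∑ b, f a b = 1

/-- Pushforward of a pmf along a map. -/
def pushf {α β : Type*} [Fintype α] (p : α → ℝ) (f : α → β) : β → ℝ :=
  fun b => ∑ a, ind (f a = b) * p a

/-- Probability of a set under a pmf. -/
def probIn {α : Type*} [Fintype α] (p : α → ℝ) (A : Set α) : ℝ :=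
  ∑ a, ind (a ∈ A) * p a

/-- Shannon entropy, in bits. -/
def entropy {α : Type*} [Fintype α] (p : α → ℝ) : ℝ :=
  -∑ a, p a * Real.logb 2 (p a)

/-- Kullback–Leibler divergence, in bits. -/
def klDiv {α : Type*} [Fintype α] (p q : α → ℝ) : ℝ :=
  ∑ a, p a * Real.logb 2 (p a / q a)

/-- Conditional entropy `H(α | β)` of a joint pmf on `α × β`, in bits. -/
def condEntropy {α β : Type*} [Fintype α] [Fintype β] (p : α × β → ℝ) : ℝ :=
  -∑ x : α × β, p x * Real.logb 2 (p x / ∑ a, p (a, x.2))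

/-- Mutual information `I(α;β)`, in bits. -/
def mutualInfo {α β : Type*} [Fintype α] [Fintype β] (p : α × β → ℝ) : ℝ :=
  ∑ x : α × β, p x * Real.logb 2 (p x / ((∑ b, p (x.1, b)) * (∑ a, p (a, x.2))))

/-- Conditional mutual information `I(α;β|γ)`, in bits. -/
def condMI {α β γ : Type*} [Fintype α] [Fintype β] [Fintype γ] (p : α × β × γ → ℝ) : ℝ :=
  ∑ x : α × β × γ, p x * Real.logb 2
    (p x * (∑ a, ∑ b, p (a, b, x.2.2)) /
      ((∑ b, p (x.1, b, x.2.2)) * (∑ a, p (a, x.2.1, x.2.2))))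

/-- Markov chain `α − β − γ`: the first and third components are conditionally
independent given the middle one. -/
def MarkovChain {α β γ : Type*} [Fintype α] [Fintype γ] (p : α × β × γ → ℝ) : Prop :=
  ∀ a b c, p (a, b, c) * (∑ a', ∑ c', p (a', b, c')) =
    (∑ c', p (a, b, c')) * (∑ a', p (a', b, c))

/-- Shannon capacity of a discrete memoryless channel, in bits per use. -/
def capacity {X Y : Type*} [Fintype X] [Fintype Y] (Ch : X → Y → ℝ) : ℝ :=
  sSup {c | ∃ q : X → ℝ, IsPMF q ∧ c = mutualInfo (fun xy : X × Y => q xy.1 * Ch xy.1 xy.2)}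

/-- Empirical distribution (type) of a length-`j` sequence. -/
def empDist {α : Type*} [Fintype α] {j : ℕ} (w : Fin j → α) : α → ℝ :=
  fun a => (∑ i, ind (w i = a)) / j

/-- δ-typicality: the empirical distribution is within δ of `p` in every coordinate. -/
def IsTypical {α : Type*} [Fintype α] (p : α → ℝ) (δ : ℝ) {j : ℕ} (w : Fin j → α) : Prop :=
  ∀ a, |empDist w a - p a| ≤ δ

section System

variable {L : ℕ} {U X Y : Fin L → Type} {V Z : Type}
variable [∀ l, Fintype (U l)] [∀ l, Fintype (X l)] [∀ l, Fintype (Y l)]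
variable [Fintype V] [Fintype Z]

/-- Joint pmf of the channel outputs `(Y₁ⁿ,…,Y_Lⁿ)`, `V^k` and `Z^k` induced by `k` i.i.d.
copies of the source `R`, the stochastic encoders `f` and the memoryless channels `Ch`. -/
def inducedDist (R : (((l : Fin L) → U l) × V × Z) → ℝ)
    (Ch : (l : Fin L) → X l → Y l → ℝ) (k n : ℕ)
    (f : (l : Fin L) → (Fin k → U l) → (Fin n → X l) → ℝ) :
    (((l : Fin L) → Fin n → Y l) × (Fin k → V) × (Fin k → Z)) → ℝ :=
  fun yvz =>
    ∑ u : (l : Fin L) → Fin k → U l, ∑ x : (l : Fin L) → Fin n → X l,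
      (∏ i : Fin k, R ((fun l => u l i), yvz.2.1 i, yvz.2.2 i)) *
        ((∏ l, f l (u l) (x l)) * ∏ l, ∏ j : Fin n, Ch l (x l j) (yvz.1 l j))

/-- `P` and `Q` have the same single-variable marginals. -/
def SameMarginals (P Q : (((l : Fin L) → U l) × V × Z) → ℝ) : Prop :=
  (∀ (l : Fin L) (a : U l),
      (∑ x : ((l : Fin L) → U l) × V × Z, ind (x.1 l = a) * P x) =
        ∑ x : ((l : Fin L) → U l) × V × Z, ind (x.1 l = a) * Q x) ∧
  (∀ v : V, (∑ x : ((l : Fin L) → U l) × V × Z, ind (x.2.1 = v) * P x) =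
      ∑ x : ((l : Fin L) → U l) × V × Z, ind (x.2.1 = v) * Q x) ∧
  (∀ z : Z, (∑ x : ((l : Fin L) → U l) × V × Z, ind (x.2.2 = z) * P x) =
      ∑ x : ((l : Fin L) → U l) × V × Z, ind (x.2.2 = z) * Q x)

/-- Testing against conditional independence: `Q = P_{U_𝓛|Z} P_{V|Z} P_Z`. -/
def IsTACI (P Q : (((l : Fin L) → U l) × V × Z) → ℝ) : Prop :=
  ∀ x : ((l : Fin L) → U l) × V × Z,
    Q x = (∑ v : V, P (x.1, v, x.2.2)) * (∑ u : (l : Fin L) → U l, P (u, x.2.1, x.2.2)) /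
      (∑ u : (l : Fin L) → U l, ∑ v : V, P (u, v, x.2.2))

/-- Optimal type-2 error probability `β(k,τ,ε)`. -/
def beta (P Q : (((l : Fin L) → U l) × V × Z) → ℝ)
    (Ch : (l : Fin L) → X l → Y l → ℝ) (τ ε : ℝ) (k : ℕ) : ℝ :=
  sInf {b | ∃ n : ℕ, (n : ℝ) ≤ τ * k ∧
    ∃ f : (l : Fin L) → (Fin k → U l) → (Fin n → X l) → ℝ,
      (∀ l, IsKernel (f l)) ∧
      ∃ A : Set (((l : Fin L) → Fin n → Y l) × (Fin k → V) × (Fin k → Z)),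
        probIn (inducedDist P Ch k n f) Aᶜ ≤ ε ∧
        b = probIn (inducedDist Q Ch k n f) A}

/-- `θ(k,τ)`. -/
def thetaK (P Q : (((l : Fin L) → U l) × V × Z) → ℝ)
    (Ch : (l : Fin L) → X l → Y l → ℝ) (τ : ℝ) (k : ℕ) : ℝ :=
  sSup {d | ∃ n : ℕ, (n : ℝ) ≤ τ * k ∧
    ∃ f : (l : Fin L) → (Fin k → U l) → (Fin n → X l) → ℝ,
      (∀ l, IsKernel (f l)) ∧
      d = klDiv (inducedDist P Ch k n f) (inducedDist Q Ch k n f) / k}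

/-- `θ(τ) = sup_{k ≥ 1} θ(k,τ)`. -/
def theta (P Q : (((l : Fin L) → U l) × V × Z) → ℝ)
    (Ch : (l : Fin L) → X l → Y l → ℝ) (τ : ℝ) : ℝ :=
  sSup {d | ∃ k : ℕ, 1 ≤ k ∧ d = thetaK P Q Ch τ k}

/-- Optimal type-2 error exponent `κ(τ,ε)`. -/
def kappa (P Q : (((l : Fin L) → U l) × V × Z) → ℝ)
    (Ch : (l : Fin L) → X l → Y l → ℝ) (τ ε : ℝ) : ℝ :=
  sSup {κ : ℝ | 0 ≤ κ ∧ ∀ δ : ℝ, 0 < δ →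
    Filter.limsup (fun k : ℕ => Real.logb 2 (beta P Q Ch τ ε k) / k) Filter.atTop ≤ -(κ - δ)}

/-- `I(V^k; Y₁ⁿ,…,Y_Lⁿ | Z^k)` of the induced distribution. -/
def miVY (P : (((l : Fin L) → U l) × V × Z) → ℝ)
    (Ch : (l : Fin L) → X l → Y l → ℝ) (k n : ℕ)
    (f : (l : Fin L) → (Fin k → U l) → (Fin n → X l) → ℝ) : ℝ :=
  condMI (fun x : (Fin k → V) × ((l : Fin L) → Fin n → Y l) × (Fin k → Z) =>
    inducedDist P Ch k n f (x.2.1, x.1, x.2.2))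

/-- `H(V^k | Y₁ⁿ,…,Y_Lⁿ, Z^k)` of the induced distribution. -/
def condEntV (P : (((l : Fin L) → U l) × V × Z) → ℝ)
    (Ch : (l : Fin L) → X l → Y l → ℝ) (k n : ℕ)
    (f : (l : Fin L) → (Fin k → U l) → (Fin n → X l) → ℝ) : ℝ :=
  condEntropy (fun x : (Fin k → V) × (((l : Fin L) → Fin n → Y l) × (Fin k → Z)) =>
    inducedDist P Ch k n f (x.2.1, x.1, x.2.2))

/-- Probability of correct decoding in the `L`-helper JSCC problem. -/
def probCorrect (P : (((l : Fin L) → U l) × V × Z) → ℝ)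
    (Ch : (l : Fin L) → X l → Y l → ℝ) (k n m : ℕ)
    (f : (l : Fin L) → (Fin k → U l) → (Fin n → X l) → ℝ)
    (φ : (Fin k → V) → Fin m)
    (g : Fin m × ((l : Fin L) → Fin n → Y l) × (Fin k → Z) → (Fin k → V)) : ℝ :=
  ∑ w : ((l : Fin L) → Fin n → Y l) × (Fin k → V) × (Fin k → Z),
    ind (g (φ w.2.1, w.1, w.2.2) = w.2.1) * inducedDist P Ch k n f w

/-- Achievability of rate `R` in the `L`-helper JSCC problem with bandwidth ratio `τ`. -/
def JSCCAchievable (P : (((l : Fin L) → U l) × V × Z) → ℝ)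
    (Ch : (l : Fin L) → X l → Y l → ℝ) (τ R : ℝ) : Prop :=
  ∀ lam : ℝ, 0 < lam → lam ≤ 1 →
    ∃ (nseq mseq : ℕ → ℕ) (δ : ℕ → ℝ)
      (f : (k : ℕ) → (l : Fin L) → (Fin k → U l) → (Fin (nseq k) → X l) → ℝ)
      (φ : (k : ℕ) → (Fin k → V) → Fin (mseq k))
      (g : (k : ℕ) → Fin (mseq k) × ((l : Fin L) → Fin (nseq k) → Y l) × (Fin k → Z) →
        (Fin k → V)),
      (∀ k, 0 ≤ δ k) ∧ Filter.Tendsto δ Filter.atTop (nhds 0) ∧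
      ∀ k : ℕ, 1 ≤ k →
        (nseq k : ℝ) ≤ τ * k ∧ 1 ≤ mseq k ∧ (∀ l, IsKernel (f k l)) ∧
        1 - lam ≤ probCorrect P Ch k (nseq k) (mseq k) (f k) (φ k) (g k) ∧
        Real.logb 2 (mseq k) / k ≤ R + δ k

/-- Optimal rate `R(τ)` of the `L`-helper JSCC problem. -/
def Rjscc (P : (((l : Fin L) → U l) × V × Z) → ℝ)
    (Ch : (l : Fin L) → X l → Y l → ℝ) (τ : ℝ) : ℝ :=
  sInf {R | JSCCAchievable P Ch τ R}

/-- `R_k`: infimum of `H(V^k|Y^n,Z^k)/k` over block lengths `n ≤ τk` and encoders. -/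
def Rk (P : (((l : Fin L) → U l) × V × Z) → ℝ)
    (Ch : (l : Fin L) → X l → Y l → ℝ) (τ : ℝ) (k : ℕ) : ℝ :=
  sInf {r | ∃ n : ℕ, (n : ℝ) ≤ τ * k ∧
    ∃ f : (l : Fin L) → (Fin k → U l) → (Fin n → X l) → ℝ,
      (∀ l, IsKernel (f l)) ∧ r = condEntV P Ch k n f / k}

end System

section SingleObserver

variable {Uu Xx Yy V Z : Type}
variable [Fintype Uu] [Fintype Xx] [Fintype Yy] [Fintype V] [Fintype Z]

/-- Single-observer induced joint pmf of `(Yⁿ, V^k, Z^k)`. -/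
def inducedDist1 (R : Uu × V × Z → ℝ) (Ch : Xx → Yy → ℝ) (k n : ℕ)
    (f : (Fin k → Uu) → (Fin n → Xx) → ℝ) :
    ((Fin n → Yy) × (Fin k → V) × (Fin k → Z)) → ℝ :=
  fun yvz => ∑ u : Fin k → Uu, ∑ x : Fin n → Xx,
    (∏ i : Fin k, R (u i, yvz.2.1 i, yvz.2.2 i)) *
      (f u x * ∏ j : Fin n, Ch (x j) (yvz.1 j))

end SingleObserver

section Aux

variable {Uu V Z Wt : Type} [Fintype Uu] [Fintype V] [Fintype Z] [Fintype Wt]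

/-- Markov chain `(Z,V) − U − W` for a joint pmf on `(U × V × Z) × W`. -/
def MarkovZVUW (J : (Uu × V × Z) × Wt → ℝ) : Prop :=
  MarkovChain (fun x : (Z × V) × Uu × Wt => J ((x.2.1, x.1.2, x.1.1), x.2.2))

/-- `I(U;W|Z)` for a joint pmf on `(U × V × Z) × W`. -/
def miUW_Z (J : (Uu × V × Z) × Wt → ℝ) : ℝ :=
  condMI (fun x : Uu × Wt × Z => ∑ v, J ((x.1, v, x.2.2), x.2.1))

/-- `I(V;W|Z)` for a joint pmf on `(U × V × Z) × W`. -/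
def miVW_Z (J : (Uu × V × Z) × Wt → ℝ) : ℝ :=
  condMI (fun x : V × Wt × Z => ∑ u, J ((u, x.1, x.2.2), x.2.1))

/-- `I(U;W|V,Z)` for a joint pmf on `(U × V × Z) × W`. -/
def miUW_VZ (J : (Uu × V × Z) × Wt → ℝ) : ℝ :=
  condMI (fun x : Uu × Wt × (V × Z) => J ((x.1, x.2.2.1, x.2.2.2), x.2.1))

/-- `H(V|W,Z)` for a joint pmf on `(U × V × Z) × W`. -/
def entV_WZ (J : (Uu × V × Z) × Wt → ℝ) : ℝ :=
  condEntropy (fun x : V × (Wt × Z) => ∑ u, J ((u, x.1, x.2.2), x.2.1))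

/-- `H(V|Z)` for a joint pmf on `U × V × Z`. -/
def entV_Z (P : Uu × V × Z → ℝ) : ℝ :=
  condEntropy (fun x : V × Z => ∑ u, P (u, x.1, x.2))

end Aux

end DHT

namespace DHT

theorem ind_true {p : Prop} (h : p) : ind p = 1 := by simp [ind, h]

theorem ind_false {p : Prop} (h : ¬p) : ind p = 0 := by simp [ind, h]

theorem ind_nonneg (p : Prop) : 0 ≤ ind p := by
  by_cases h : p <;> simp [ind, h]

section FinitePMF

variable {α : Type*} [Fintype α] {p q : α → ℝ}

theorem probIn_nonneg (hp : ∀ a, 0 ≤ p a) (A : Set α) : 0 ≤ probIn p A :=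
  Finset.sum_nonneg fun a _ => mul_nonneg (ind_nonneg _) (hp a)

theorem probIn_add_compl (p : α → ℝ) (A : Set α) : probIn p A + probIn p Aᶜ = ∑ a, p a := by
  unfold probIn
  rw [← Finset.sum_add_distrib]
  refine Finset.sum_congr rfl fun a _ => ?_
  by_cases h : a ∈ A <;> simp [ind, h]

theorem sum_piProd_eq_one (hp : ∑ a, p a = 1) (N : ℕ) :
    ∑ w : Fin N → α, ∏ i, p (w i) = 1 := by
  rw [← Fintype.prod_sum (fun (_ : Fin N) a => p a)]
  simp [hp]

theorem sum_piProd_succ (p : α → ℝ) (N : ℕ) (g : (Fin (N + 1) → α) → ℝ) :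
    ∑ w : Fin (N + 1) → α, (∏ i, p (w i)) * g w =
      ∑ a, ∑ w : Fin N → α, p a * (∏ i, p (w i)) * g (Fin.cons a w) := by
  rw [← (Fin.consEquiv fun _ => α).sum_comp, Fintype.sum_prod_type]
  simp [Fin.consEquiv, Fin.prod_univ_succ]

/-- The second moment of a sum of i.i.d. centred variables. -/
theorem sum_piProd_sq_sum (hp : ∑ a, p a = 1) {h : α → ℝ} (hh : ∑ a, p a * h a = 0) (N : ℕ) :
    ∑ w : Fin N → α, (∏ i, p (w i)) * (∑ i, h (w i)) ^ 2 = N * ∑ a, p a * h a ^ 2 := by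
  induction N with
  | zero => simp
  | succ N ih =>
    rw [sum_piProd_succ]
    have key : ∀ a, ∑ w : Fin N → α,
        p a * (∏ i, p (w i)) * (∑ i, h ((Fin.cons a w : Fin (N + 1) → α) i)) ^ 2 =
        p a * h a ^ 2 * (∑ w : Fin N → α, ∏ i, p (w i)) +
          p a * h a * (2 * ∑ w : Fin N → α, (∏ i, p (w i)) * ∑ i, h (w i)) +
          p a * ∑ w : Fin N → α, (∏ i, p (w i)) * (∑ i, h (w i)) ^ 2 := by
      intro a
      simp only [Finset.mul_sum (s := (Finset.univ : Finset (Fin N → α))),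
        ← Finset.sum_add_distrib]
      refine Finset.sum_congr rfl fun w _ => ?_
      rw [Fin.sum_univ_succ]
      simp only [Fin.cons_zero, Fin.cons_succ]
      ring
    simp only [key, Finset.sum_add_distrib, ← Finset.sum_mul, ih, sum_piProd_eq_one hp, hh, hp]
    push_cast
    ring

/-- Likelihood-ratio acceptance region on blocks of length `N` at exponent rate `c`. -/
def lrRegion (p q : α → ℝ) (c : ℝ) (N : ℕ) : Set (Fin N → α) :=
  {w | (2 : ℝ) ^ (N * c) * ∏ i, q (w i) ≤ ∏ i, p (w i)}

theorem probIn_lrRegion_le (hp : IsPMF p) (c : ℝ) (N : ℕ) :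
    probIn (fun w : Fin N → α => ∏ i, q (w i)) (lrRegion p q c N) ≤ 2 ^ (-(N * c)) := by
  have hpos : (0 : ℝ) < 2 ^ (N * c) := by positivity
  calc probIn (fun w : Fin N → α => ∏ i, q (w i)) (lrRegion p q c N)
      ≤ ∑ w : Fin N → α, 2 ^ (-(N * c)) * ∏ i, p (w i) := by
        refine Finset.sum_le_sum fun w _ => ?_
        have hprod : 0 ≤ ∏ i, p (w i) := Finset.prod_nonneg fun i _ => hp.1 _
        by_cases hw : w ∈ lrRegion p q c N
        · rw [ind_true hw, one_mul, Real.rpow_neg (by norm_num), ← div_eq_inv_mul,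
            le_div_iff₀ hpos, mul_comm]
          exact hw
        · rw [ind_false hw, zero_mul]
          positivity
    _ = 2 ^ (-(N * c)) := by rw [← Finset.mul_sum, sum_piProd_eq_one hp.2, mul_one]

theorem probIn_lrRegion_compl_le (hp : IsPMF p) (hpq : ∀ a, 0 < p a → 0 < q a) {δ : ℝ}
    (hδ : 0 < δ) {N : ℕ} (hN : 0 < N) :
    probIn (fun w : Fin N → α => ∏ i, p (w i)) (lrRegion p q (klDiv p q - δ) N)ᶜ ≤
      (∑ a, p a * (Real.logb 2 (p a / q a) - klDiv p q) ^ 2) / δ ^ 2 / N := by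
  set h : α → ℝ := fun a => Real.logb 2 (p a / q a) - klDiv p q with hdef
  have hh : ∑ a, p a * h a = 0 := by
    simp only [hdef, mul_sub, Finset.sum_sub_distrib, ← Finset.sum_mul, hp.2]
    simp [klDiv]
  have hNpos : (0 : ℝ) < N := by exact_mod_cast hN
  have hcheb : ∀ w : Fin N → α,
      ind (w ∈ (lrRegion p q (klDiv p q - δ) N)ᶜ) * ∏ i, p (w i) ≤
        ((∏ i, p (w i)) * (∑ i, h (w i)) ^ 2) / (N * δ) ^ 2 := by
    intro w
    have hprod : 0 ≤ ∏ i, p (w i) := Finset.prod_nonneg fun i _ => hp.1 _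
    by_cases hw : w ∈ lrRegion p q (klDiv p q - δ) N
    · rw [ind_false (by simpa using hw), zero_mul]
      positivity
    rw [ind_true (by simpa using hw), one_mul, le_div_iff₀ (by positivity)]
    rcases hprod.eq_or_lt with h0 | hpos
    · simp [← h0]
    refine mul_le_mul_of_nonneg_left ?_ hprod
    have hpi : ∀ i, 0 < p (w i) := fun i =>
      (hp.1 _).lt_of_ne fun h0 => hpos.ne' (Finset.prod_eq_zero (Finset.mem_univ i) h0.symm)
    have hqi : ∀ i, 0 < q (w i) := fun i => hpq _ (hpi i)
    have hqpos : 0 < ∏ i, q (w i) := Finset.prod_pos fun i _ => hqi i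
    have hsum : ∑ i, Real.logb 2 (p (w i) / q (w i)) < N * (klDiv p q - δ) := by
      have hlt : (∏ i, p (w i)) / (∏ i, q (w i)) < (2 : ℝ) ^ (N * (klDiv p q - δ)) := by
        rw [div_lt_iff₀ hqpos]
        exact not_le.mp hw
      rw [← Real.logb_prod _ _ fun i _ => (div_pos (hpi i) (hqi i)).ne', Finset.prod_div_distrib]
      exact (Real.logb_lt_iff_lt_rpow (by norm_num) (by positivity)).mpr hlt
    have hneg : ∑ i, h (w i) ≤ -(N * δ) := by
      simp only [hdef, Finset.sum_sub_distrib, Finset.sum_const, Finset.card_univ,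
        Fintype.card_fin, nsmul_eq_mul]
      linarith
    have hδN : 0 < N * δ := by positivity
    nlinarith
  calc probIn (fun w : Fin N → α => ∏ i, p (w i)) (lrRegion p q (klDiv p q - δ) N)ᶜ
      ≤ ∑ w : Fin N → α, ((∏ i, p (w i)) * (∑ i, h (w i)) ^ 2) / (N * δ) ^ 2 :=
        Finset.sum_le_sum fun w _ => hcheb w
    _ = (∑ a, p a * h a ^ 2) / δ ^ 2 / N := by
        rw [← Finset.sum_div, sum_piProd_sq_sum hp.2 hh]
        field_simp

end FinitePMF

section Simulation

set_option linter.unusedSectionVars false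

variable {L : ℕ} {U X Y : Fin L → Type} {V Z : Type}
variable [∀ l, Fintype (U l)] [∀ l, Fintype (X l)] [∀ l, Fintype (Y l)]
variable [Fintype V] [Fintype Z]

theorem inducedDist_nonneg {R : (((l : Fin L) → U l) × V × Z) → ℝ} (hR : ∀ x, 0 ≤ R x)
    {Ch : (l : Fin L) → X l → Y l → ℝ} (hCh : ∀ l, IsKernel (Ch l)) {k n : ℕ}
    {f : (l : Fin L) → (Fin k → U l) → (Fin n → X l) → ℝ} (hf : ∀ l, IsKernel (f l)) (ω) :
    0 ≤ inducedDist R Ch k n f ω := by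
  refine Finset.sum_nonneg fun u _ => Finset.sum_nonneg fun x _ => mul_nonneg ?_ (mul_nonneg ?_ ?_)
  · exact Finset.prod_nonneg fun i _ => hR _
  · exact Finset.prod_nonneg fun l _ => (hf l _).1 _
  · exact Finset.prod_nonneg fun l _ => Finset.prod_nonneg fun j _ => (hCh l _).1 _

theorem sum_inducedDist {R : (((l : Fin L) → U l) × V × Z) → ℝ} (hR : ∑ x, R x = 1)
    {Ch : (l : Fin L) → X l → Y l → ℝ} (hCh : ∀ l, IsKernel (Ch l)) {k n : ℕ}
    {f : (l : Fin L) → (Fin k → U l) → (Fin n → X l) → ℝ} (hf : ∀ l, IsKernel (f l)) :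
    ∑ ω, inducedDist R Ch k n f ω = 1 := by
  have hy : ∀ x : (l : Fin L) → Fin n → X l,
      ∑ y : (l : Fin L) → Fin n → Y l, ∏ l, ∏ j, Ch l (x l j) (y l j) = 1 := by
    intro x
    rw [← Fintype.prod_sum (fun l (y : Fin n → Y l) => ∏ j, Ch l (x l j) (y j))]
    refine Finset.prod_eq_one fun l _ => ?_
    rw [← Fintype.prod_sum (fun j b => Ch l (x l j) b)]
    exact Finset.prod_eq_one fun j _ => (hCh l _).2
  have hx : ∀ u : (l : Fin L) → Fin k → U l,
      ∑ x : (l : Fin L) → Fin n → X l, ∏ l, f l (u l) (x l) = 1 := by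
    intro u
    rw [← Fintype.prod_sum (fun l x => f l (u l) x)]
    exact Finset.prod_eq_one fun l _ => (hf l _).2
  let e : (Fin k → ((l : Fin L) → U l) × V × Z) ≃
      ((l : Fin L) → Fin k → U l) × (Fin k → V) × (Fin k → Z) :=
    (Equiv.arrowProdEquivProdArrow _ _ _).trans
      ((Equiv.piComm _).prodCongr (Equiv.arrowProdEquivProdArrow _ _ _))
  have hsrc : ∑ s : ((l : Fin L) → Fin k → U l) × (Fin k → V) × (Fin k → Z),
      ∏ i, R ((fun l => s.1 l i), s.2.1 i, s.2.2 i) = 1 := by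
    rw [← e.sum_comp, ← sum_piProd_eq_one hR k]
    rfl
  calc ∑ ω, inducedDist R Ch k n f ω
      = ∑ vz : (Fin k → V) × (Fin k → Z), ∑ u : (l : Fin L) → Fin k → U l,
          (∏ i, R ((fun l => u l i), vz.1 i, vz.2 i)) *
          ∑ x : (l : Fin L) → Fin n → X l, (∏ l, f l (u l) (x l)) *
            ∑ y : (l : Fin L) → Fin n → Y l, ∏ l, ∏ j, Ch l (x l j) (y l j) := by
        rw [Fintype.sum_prod_type_right]
        refine Finset.sum_congr rfl fun vz _ => ?_
        unfold inducedDist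
        rw [Finset.sum_comm]
        refine Finset.sum_congr rfl fun u _ => ?_
        rw [Finset.sum_comm, Finset.mul_sum]
        refine Finset.sum_congr rfl fun x _ => ?_
        simp only [Finset.mul_sum]
    _ = 1 := by
        simp only [hy, mul_one, hx]
        rw [← hsrc]
        exact (Fintype.sum_prod_type_right
          fun s : ((l : Fin L) → Fin k → U l) × (Fin k → V) × (Fin k → Z) =>
            ∏ i, R ((fun l => s.1 l i), s.2.1 i, s.2.2 i)).symm

theorem isPMF_inducedDist {R : (((l : Fin L) → U l) × V × Z) → ℝ} (hR : IsPMF R)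
    {Ch : (l : Fin L) → X l → Y l → ℝ} (hCh : ∀ l, IsKernel (Ch l)) {k n : ℕ}
    {f : (l : Fin L) → (Fin k → U l) → (Fin n → X l) → ℝ} (hf : ∀ l, IsKernel (f l)) :
    IsPMF (inducedDist R Ch k n f) :=
  ⟨inducedDist_nonneg hR.1 hCh hf, sum_inducedDist hR.2 hCh hf⟩

theorem inducedDist_le_pow_mul {P Q : (((l : Fin L) → U l) × V × Z) → ℝ} (hP : ∀ x, 0 ≤ P x)
    {C : ℝ} (hC : ∀ x, P x ≤ C * Q x)
    {Ch : (l : Fin L) → X l → Y l → ℝ} (hCh : ∀ l, IsKernel (Ch l)) {k n : ℕ}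
    {f : (l : Fin L) → (Fin k → U l) → (Fin n → X l) → ℝ} (hf : ∀ l, IsKernel (f l)) (ω) :
    inducedDist P Ch k n f ω ≤ C ^ k * inducedDist Q Ch k n f ω := by
  unfold inducedDist
  simp only [Finset.mul_sum]
  refine Finset.sum_le_sum fun u _ => Finset.sum_le_sum fun x _ => ?_
  rw [← mul_assoc (C ^ k)]
  refine mul_le_mul_of_nonneg_right ?_
    (mul_nonneg (Finset.prod_nonneg fun l _ => (hf l _).1 _)
      (Finset.prod_nonneg fun l _ => Finset.prod_nonneg fun j _ => (hCh l _).1 _))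
  calc ∏ i : Fin k, P ((fun l => u l i), ω.2.1 i, ω.2.2 i)
      ≤ ∏ i : Fin k, C * Q ((fun l => u l i), ω.2.1 i, ω.2.2 i) :=
        Finset.prod_le_prod (fun i _ => hP _) fun i _ => hC _
    _ = _ := by simp [Finset.prod_mul_distrib]

/-- Coordinatewise concatenation of two families of sequences. -/
def appendPiEquiv (A : Fin L → Type) (m m' : ℕ) :
    ((l : Fin L) → Fin m → A l) × ((l : Fin L) → Fin m' → A l) ≃
      ((l : Fin L) → Fin (m + m') → A l) :=
  (Equiv.arrowProdEquivProdArrow (Fin L) _ _).symm.trans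
    (Equiv.piCongrRight fun _ => Fin.appendEquiv m m')

/-- Concatenation of two observations available to the detector. -/
def appendObsEquiv (Y : Fin L → Type) (V Z : Type) (m n m' n' : ℕ) :
    (((l : Fin L) → Fin n → Y l) × (Fin m → V) × (Fin m → Z)) ×
      (((l : Fin L) → Fin n' → Y l) × (Fin m' → V) × (Fin m' → Z)) ≃
      ((l : Fin L) → Fin (n + n') → Y l) × (Fin (m + m') → V) × (Fin (m + m') → Z) :=
  (Equiv.prodProdProdComm _ _ _ _).trans ((appendPiEquiv Y n n').prodCongr
    ((Equiv.prodProdProdComm _ _ _ _).trans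
      ((Fin.appendEquiv m m').prodCongr (Fin.appendEquiv m m'))))

/-- The encoders that use `f` and then `f'` on consecutive blocks. -/
def appendEnc {m n m' n' : ℕ} (f : (l : Fin L) → (Fin m → U l) → (Fin n → X l) → ℝ)
    (f' : (l : Fin L) → (Fin m' → U l) → (Fin n' → X l) → ℝ) :
    (l : Fin L) → (Fin (m + m') → U l) → (Fin (n + n') → X l) → ℝ :=
  fun l u x => f l (fun i => u (Fin.castAdd m' i)) (fun j => x (Fin.castAdd n' j)) *
    f' l (fun i => u (Fin.natAdd m i)) (fun j => x (Fin.natAdd n j))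

theorem isKernel_appendEnc {m n m' n' : ℕ}
    {f : (l : Fin L) → (Fin m → U l) → (Fin n → X l) → ℝ}
    {f' : (l : Fin L) → (Fin m' → U l) → (Fin n' → X l) → ℝ}
    (hf : ∀ l, IsKernel (f l)) (hf' : ∀ l, IsKernel (f' l)) (l : Fin L) :
    IsKernel (appendEnc f f' l) := by
  refine fun u => ⟨fun x => mul_nonneg ((hf l _).1 _) ((hf' l _).1 _), ?_⟩
  rw [← (Fin.appendEquiv n n').sum_comp, Fintype.sum_prod_type]
  simp [appendEnc, Fin.appendEquiv, ← Finset.mul_sum, (hf' l _).2, (hf l _).2]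

theorem inducedDist_appendEnc (R : (((l : Fin L) → U l) × V × Z) → ℝ)
    (Ch : (l : Fin L) → X l → Y l → ℝ) {m n m' n' : ℕ}
    (f : (l : Fin L) → (Fin m → U l) → (Fin n → X l) → ℝ)
    (f' : (l : Fin L) → (Fin m' → U l) → (Fin n' → X l) → ℝ) (a b) :
    inducedDist R Ch (m + m') (n + n') (appendEnc f f') (appendObsEquiv Y V Z m n m' n' (a, b)) =
      inducedDist R Ch m n f a * inducedDist R Ch m' n' f' b := by
  unfold inducedDist
  rw [← (appendPiEquiv U m m').sum_comp, Fintype.sum_prod_type, Finset.sum_mul_sum]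
  refine Finset.sum_congr rfl fun u _ => Finset.sum_congr rfl fun u' _ => ?_
  rw [← (appendPiEquiv X n n').sum_comp, Fintype.sum_prod_type, Finset.sum_mul_sum]
  refine Finset.sum_congr rfl fun x _ => Finset.sum_congr rfl fun x' _ => ?_
  simp only [appendPiEquiv, appendObsEquiv, appendEnc, Fin.appendEquiv, Fin.prod_univ_add,
    Finset.prod_mul_distrib, Equiv.trans_apply, Equiv.prodCongr_apply, Prod.map,
    Equiv.prodProdProdComm_apply, Equiv.piCongrRight_apply, Equiv.coe_fn_mk, Pi.map,
    Equiv.arrowProdEquivProdArrow, Equiv.coe_fn_symm_mk, Fin.append_left, Fin.append_right]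
  ring

/-- Some encoders on `m` source symbols and `n` channel uses, followed by a processing of the
detector's observation, turn every source law `R` into the law `F R`. -/
def Simulates (Ch : (l : Fin L) → X l → Y l → ℝ) (m n : ℕ) {W : Type} [Fintype W]
    (F : ((((l : Fin L) → U l) × V × Z) → ℝ) → W → ℝ) : Prop :=
  ∃ f : (l : Fin L) → (Fin m → U l) → (Fin n → X l) → ℝ, (∀ l, IsKernel (f l)) ∧
    ∃ T : (((l : Fin L) → Fin n → Y l) × (Fin m → V) × (Fin m → Z)) → W,
      ∀ R, IsPMF R → ∀ g : W → ℝ,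
        ∑ ω, inducedDist R Ch m n f ω * g (T ω) = ∑ w, F R w * g w

namespace Simulates

variable {Ch : (l : Fin L) → X l → Y l → ℝ} {W W' : Type} [Fintype W] [Fintype W']
variable {F : ((((l : Fin L) → U l) × V × Z) → ℝ) → W → ℝ}
variable {F' : ((((l : Fin L) → U l) × V × Z) → ℝ) → W' → ℝ}

theorem inducedDist {k n : ℕ} {f : (l : Fin L) → (Fin k → U l) → (Fin n → X l) → ℝ}
    (hf : ∀ l, IsKernel (f l)) :
    Simulates Ch k n (fun R : (((l : Fin L) → U l) × V × Z) → ℝ =>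
      DHT.inducedDist R Ch k n f) :=
  ⟨f, hf, id, fun _ _ _ => rfl⟩

theorem of_unique (hCh : ∀ l, IsKernel (Ch l)) (r : ℕ) [Unique W] :
    Simulates Ch r 0 (fun (_ : (((l : Fin L) → U l) × V × Z) → ℝ) (_ : W) => 1) := by
  have hf : ∀ l : Fin L, IsKernel (fun (_ : Fin r → U l) (_ : Fin 0 → X l) => (1 : ℝ)) :=
    fun l u => ⟨fun _ => zero_le_one, by simp⟩
  refine ⟨_, hf, fun _ => default, fun R hR g => ?_⟩
  rw [← Finset.sum_mul, sum_inducedDist hR.2 hCh hf]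
  simp

theorem comp_equiv {m n : ℕ} (h : Simulates Ch m n F) (e : W' ≃ W) :
    Simulates Ch m n (fun R w => F R (e w)) := by
  obtain ⟨f, hf, T, hT⟩ := h
  refine ⟨f, hf, fun ω => e.symm (T ω), fun R hR g => ?_⟩
  rw [hT R hR fun w => g (e.symm w), ← e.sum_comp]
  simp

theorem prod {m n m' n' : ℕ} (h : Simulates Ch m n F) (h' : Simulates Ch m' n' F') :
    Simulates Ch (m + m') (n + n') (fun R (w : W × W') => F R w.1 * F' R w.2) := by
  obtain ⟨f, hf, T, hT⟩ := h
  obtain ⟨f', hf', T', hT'⟩ := h'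
  let e := appendObsEquiv Y V Z m n m' n'
  refine ⟨appendEnc f f', isKernel_appendEnc hf hf',
    fun ω => (T (e.symm ω).1, T' (e.symm ω).2), fun R hR g => ?_⟩
  rw [← e.sum_comp, Fintype.sum_prod_type]
  simp only [Equiv.symm_apply_apply, e, inducedDist_appendEnc]
  have inner : ∀ a, ∑ b, DHT.inducedDist R Ch m n f a * DHT.inducedDist R Ch m' n' f' b *
      g (T a, T' b) = DHT.inducedDist R Ch m n f a * ∑ w', F' R w' * g (T a, w') := by
    intro a
    rw [← hT' R hR fun w' => g (T a, w'), Finset.mul_sum]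
    exact Finset.sum_congr rfl fun b _ => by ring
  simp only [inner]
  rw [hT R hR fun w => ∑ w', F' R w' * g (w, w'), Fintype.sum_prod_type]
  refine Finset.sum_congr rfl fun w _ => ?_
  rw [Finset.mul_sum]
  exact Finset.sum_congr rfl fun w' _ => by ring

theorem pad (hCh : ∀ l, IsKernel (Ch l)) {m n : ℕ} (h : Simulates Ch m n F) (r : ℕ) :
    Simulates Ch (m + r) n F := by
  simpa using (h.prod (of_unique (W := Unit) hCh r)).comp_equiv (Equiv.prodPUnit W).symm

theorem pow (hCh : ∀ l, IsKernel (Ch l)) {k n : ℕ} (h : Simulates Ch k n F) (N : ℕ) :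
    Simulates Ch (k * N) (n * N) (fun R (w : Fin N → W) => ∏ i, F R (w i)) := by
  induction N with
  | zero => simpa using of_unique (U := U) (V := V) (Z := Z) (W := Fin 0 → W) hCh 0
  | succ N ih =>
    have := (ih.prod h).comp_equiv
      ((Fin.consEquiv fun _ => W).symm.trans (Equiv.prodComm _ _))
    simp only [Fin.prod_univ_succ]
    simpa [Fin.consEquiv, Fin.tail, mul_comm, Nat.mul_succ] using this

theorem beta_le {m n : ℕ} (h : Simulates Ch m n F) (hCh : ∀ l, IsKernel (Ch l))
    {P Q : (((l : Fin L) → U l) × V × Z) → ℝ} (hP : IsPMF P) (hQ : IsPMF Q)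
    {τ ε : ℝ} (hn : (n : ℝ) ≤ τ * m) (B : Set W) (hB : probIn (F P) Bᶜ ≤ ε) :
    beta P Q Ch τ ε m ≤ probIn (F Q) B := by
  obtain ⟨f, hf, T, hT⟩ := h
  have hprob : ∀ R, IsPMF R → ∀ S : Set W,
      probIn (DHT.inducedDist R Ch m n f) (T ⁻¹' S) = probIn (F R) S := by
    intro R hR S
    have := hT R hR fun w => ind (w ∈ S)
    simpa [probIn, mul_comm] using this
  refine csInf_le ⟨0, ?_⟩ ⟨n, hn, f, hf, T ⁻¹' B, ?_, (hprob Q hQ B).symm⟩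
  · rintro _ ⟨n', -, f', hf', A, -, rfl⟩
    exact probIn_nonneg (inducedDist_nonneg hQ.1 hCh hf') A
  · rw [← Set.preimage_compl, hprob P hP]
    exact hB

end Simulates

theorem exists_le_mul {P Q : (((l : Fin L) → U l) × V × Z) → ℝ} (hP : IsPMF P)
    (hQpos : ∀ x, 0 < Q x) : ∃ C : ℝ, 0 < C ∧ ∀ x, P x ≤ C * Q x := by
  have hterm : ∀ x, 1 / Q x ≤ ∑ y, 1 / Q y := fun x =>
    Finset.single_le_sum (f := fun y => 1 / Q y) (fun y _ => (one_div_pos.mpr (hQpos y)).le)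
      (Finset.mem_univ x)
  have hle : ∀ x, P x ≤ (∑ y, 1 / Q y) * Q x := by
    intro x
    calc P x ≤ ∑ y, P y := Finset.single_le_sum (fun y _ => hP.1 y) (Finset.mem_univ x)
      _ = 1 / Q x * Q x := by rw [hP.2, one_div_mul_cancel (hQpos x).ne']
      _ ≤ _ := mul_le_mul_of_nonneg_right (hterm x) (hQpos x).le
  obtain ⟨x⟩ : Nonempty (((l : Fin L) → U l) × V × Z) := by
    by_contra hne
    rw [not_nonempty_iff] at hne
    simpa using hP.2
  exact ⟨_, (one_div_pos.mpr (hQpos x)).trans_le (hterm x), hle⟩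

theorem exists_isKernel_zero (U X : Fin L → Type) [∀ l, Fintype (X l)] (m : ℕ) :
    ∃ f : (l : Fin L) → (Fin m → U l) → (Fin 0 → X l) → ℝ, ∀ l, IsKernel (f l) :=
  ⟨fun _ _ _ => 1, fun l u => ⟨fun _ => zero_le_one, by simp⟩⟩

theorem le_beta {P Q : (((l : Fin L) → U l) × V × Z) → ℝ} (hP : IsPMF P)
    {C : ℝ} (hC0 : 0 < C) (hC : ∀ x, P x ≤ C * Q x)
    {Ch : (l : Fin L) → X l → Y l → ℝ} (hCh : ∀ l, IsKernel (Ch l)) {τ ε : ℝ} (hτ : 0 < τ)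
    (hε : 0 < ε) (m : ℕ) : (1 - ε) / C ^ m ≤ beta P Q Ch τ ε m := by
  refine le_csInf ?_ ?_
  · obtain ⟨f, hf⟩ := exists_isKernel_zero U X m
    refine ⟨_, 0, by push_cast; positivity, f, hf, Set.univ, ?_, rfl⟩
    simpa [probIn, ind] using hε.le
  · rintro _ ⟨n, -, f, hf, A, hA, rfl⟩
    rw [div_le_iff₀ (by positivity)]
    have htot := probIn_add_compl (inducedDist P Ch m n f) A
    rw [sum_inducedDist hP.2 hCh hf] at htot
    calc 1 - ε ≤ probIn (inducedDist P Ch m n f) A := by linarith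
      _ ≤ ∑ ω, C ^ m * (ind (ω ∈ A) * inducedDist Q Ch m n f ω) := by
          refine Finset.sum_le_sum fun ω _ => ?_
          rw [mul_left_comm]
          exact mul_le_mul_of_nonneg_left (inducedDist_le_pow_mul hP.1 hC hCh hf ω)
            (ind_nonneg _)
      _ = _ := by rw [← Finset.mul_sum, mul_comm]; rfl

theorem beta_pos {P Q : (((l : Fin L) → U l) × V × Z) → ℝ} (hP : IsPMF P)
    (hQpos : ∀ x, 0 < Q x) {Ch : (l : Fin L) → X l → Y l → ℝ} (hCh : ∀ l, IsKernel (Ch l))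
    {τ ε : ℝ} (hτ : 0 < τ) (hε : 0 < ε) (hε1 : ε < 1) (m : ℕ) : 0 < beta P Q Ch τ ε m := by
  obtain ⟨C, hC0, hC⟩ := exists_le_mul hP hQpos
  exact (div_pos (by linarith) (pow_pos hC0 m)).trans_le (le_beta hP hC0 hC hCh hτ hε m)

theorem isCoboundedUnder_logb_beta {P Q : (((l : Fin L) → U l) × V × Z) → ℝ} (hP : IsPMF P)
    (hQpos : ∀ x, 0 < Q x) {Ch : (l : Fin L) → X l → Y l → ℝ} (hCh : ∀ l, IsKernel (Ch l))
    {τ ε : ℝ} (hτ : 0 < τ) (hε : 0 < ε) (hε1 : ε < 1) :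
    Filter.IsCoboundedUnder (· ≤ ·) Filter.atTop
      (fun m : ℕ => Real.logb 2 (beta P Q Ch τ ε m) / m) := by
  obtain ⟨C, hC0, hC⟩ := exists_le_mul hP hQpos
  refine Filter.IsBoundedUnder.isCoboundedUnder_le
    ⟨Real.logb 2 (1 - ε) - Real.logb 2 C, Filter.eventually_map.mpr ?_⟩
  filter_upwards [Filter.eventually_ge_atTop 1] with m hm
  have hm1 : (1 : ℝ) ≤ m := by exact_mod_cast hm
  have hlog : Real.logb 2 (1 - ε) - m * Real.logb 2 C ≤ Real.logb 2 (beta P Q Ch τ ε m) := by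
    rw [← Real.logb_pow, ← Real.logb_div (by linarith) (by positivity)]
    exact Real.logb_le_logb_of_le (by norm_num) (div_pos (by linarith) (by positivity))
      (le_beta hP hC0 hC hCh hτ hε m)
  have hneg : Real.logb 2 (1 - ε) ≤ 0 :=
    Real.logb_nonpos (by norm_num) (by linarith) (by linarith)
  rw [le_div_iff₀ (by linarith)]
  nlinarith

theorem logb_beta_le {P Q : (((l : Fin L) → U l) × V × Z) → ℝ} (hP : IsPMF P) (hQ : IsPMF Q)
    (hQpos : ∀ x, 0 < Q x) {Ch : (l : Fin L) → X l → Y l → ℝ} (hCh : ∀ l, IsKernel (Ch l))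
    {τ : ℝ} (hτ : 0 < τ) {k n : ℕ} (hn : (n : ℝ) ≤ τ * k)
    {f : (l : Fin L) → (Fin k → U l) → (Fin n → X l) → ℝ} (hf : ∀ l, IsKernel (f l))
    {ε : ℝ} (hε : 0 < ε) (hε1 : ε < 1) {δ : ℝ} (hδ : 0 < δ) :
    ∀ᶠ N : ℕ in Filter.atTop, ∀ r : ℕ, Real.logb 2 (beta P Q Ch τ ε (k * N + r)) ≤
      -(N * (klDiv (inducedDist P Ch k n f) (inducedDist Q Ch k n f) - δ)) := by
  set p := inducedDist P Ch k n f
  set q := inducedDist Q Ch k n f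
  have hp : IsPMF p := isPMF_inducedDist hP hCh hf
  have hpq : ∀ a, 0 < p a → 0 < q a := by
    obtain ⟨C, hC0, hC⟩ := exists_le_mul hP hQpos
    intro a ha
    exact pos_of_mul_pos_right (ha.trans_le (inducedDist_le_pow_mul hP.1 hC hCh hf a))
      (pow_pos hC0 k).le
  have hlim := tendsto_const_div_atTop_nhds_zero_nat
    ((∑ a, p a * (Real.logb 2 (p a / q a) - klDiv p q) ^ 2) / δ ^ 2)
  filter_upwards [hlim.eventually_le_const hε, Filter.eventually_gt_atTop 0] with N hN hN0 r
  have hsim := ((Simulates.inducedDist (V := V) (Z := Z) (Ch := Ch) hf).pow hCh N).pad hCh r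
  have hrate : ((n * N : ℕ) : ℝ) ≤ τ * ((k * N + r : ℕ) : ℝ) := by
    push_cast
    nlinarith [mul_le_mul_of_nonneg_right hn (Nat.cast_nonneg (α := ℝ) N),
      mul_nonneg hτ.le (Nat.cast_nonneg (α := ℝ) r)]
  have hle := hsim.beta_le hCh hP hQ hrate (lrRegion p q (klDiv p q - δ) N)
    ((probIn_lrRegion_compl_le hp hpq hδ hN0).trans hN)
  rw [Real.logb_le_iff_le_rpow (by norm_num) (beta_pos hP hQpos hCh hτ hε hε1 _)]
  exact hle.trans (probIn_lrRegion_le hp _ N)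

theorem limsup_logb_beta_le {P Q : (((l : Fin L) → U l) × V × Z) → ℝ} (hP : IsPMF P)
    (hQ : IsPMF Q) (hQpos : ∀ x, 0 < Q x) {Ch : (l : Fin L) → X l → Y l → ℝ}
    (hCh : ∀ l, IsKernel (Ch l)) {τ : ℝ} (hτ : 0 < τ) {k n : ℕ} (hk : 1 ≤ k)
    (hn : (n : ℝ) ≤ τ * k) {f : (l : Fin L) → (Fin k → U l) → (Fin n → X l) → ℝ}
    (hf : ∀ l, IsKernel (f l)) {ε : ℝ} (hε : 0 < ε) (hε1 : ε < 1) :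
    Filter.limsup (fun m : ℕ => Real.logb 2 (beta P Q Ch τ ε m) / m) Filter.atTop ≤
      -(klDiv (inducedDist P Ch k n f) (inducedDist Q Ch k n f) / k) := by
  set D := klDiv (inducedDist P Ch k n f) (inducedDist Q Ch k n f)
  have hk0 : (0 : ℝ) < k := by exact_mod_cast hk
  refine le_of_forall_pos_le_add fun η hη => ?_
  refine Filter.limsup_le_of_le (isCoboundedUnder_logb_beta hP hQpos hCh hτ hε hε1) ?_
  have hδ : 0 < η * k / 2 := by positivity
  have hblocks : Filter.Tendsto (fun m : ℕ => ((m / k : ℕ) : ℝ) / m) Filter.atTop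
      (nhds (1 / k)) := by
    have := (tendsto_nat_floor_mul_div_atTop (R := ℝ) (a := 1 / k) (by positivity)).comp
      tendsto_natCast_atTop_atTop
    refine this.congr fun m => ?_
    simp only [Function.comp_apply]
    rw [one_div_mul_eq_div, Nat.floor_div_eq_div]
  have hlim := (hblocks.mul_const (D - η * k / 2)).neg
  have hlt : -(1 / k * (D - η * k / 2)) < -(D / k) + η := by
    have : 1 / k * (D - η * k / 2) = D / k - η / 2 := by field_simp
    linarith
  filter_upwards [hlim.eventually_lt_const hlt,
    (Nat.tendsto_div_const_atTop (by omega : k ≠ 0)).eventually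
      (logb_beta_le hP hQ hQpos hCh hτ hn hf hε hε1 hδ)] with m hm hbeta
  have := hbeta (m % k)
  rw [Nat.div_add_mod] at this
  calc Real.logb 2 (beta P Q Ch τ ε m) / m
      ≤ -(((m / k : ℕ) : ℝ) * (D - η * k / 2)) / m := by gcongr
    _ = -(((m / k : ℕ) : ℝ) / m * (D - η * k / 2)) := by ring
    _ ≤ _ := hm.le

end Simulation

end DHT

open DHT Filter Real

/-- For fixed `k`, `n ≤ τk` and encoders, for every `ε ∈ (0,1)`,
`limsup_{m→∞} (1/m) log₂ β(m,τ,ε) ≤ −D(P_{Y^n V^k Z^k} ‖ Q_{Y^n V^k Z^k})/k`;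
in particular `limsup_{m→∞} (1/m) log₂ β(m,τ,ε) ≤ −θ(k,τ)` for every fixed `k ≥ 1`. -/
theorem statement_19 {L : ℕ} {U X Y : Fin L → Type} {V Z : Type}
    [∀ l, Fintype (U l)] [∀ l, Fintype (X l)] [∀ l, Fintype (Y l)]
    [Fintype V] [Fintype Z]
    (P Q : (((l : Fin L) → U l) × V × Z) → ℝ)
    (hP : IsPMF P) (hQ : IsPMF Q) (hmarg : SameMarginals P Q) (hQpos : ∀ x, 0 < Q x)
    (Ch : (l : Fin L) → X l → Y l → ℝ) (hCh : ∀ l, IsKernel (Ch l))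
    (τ : ℝ) (hτ : 0 < τ)
    (k n : ℕ) (hk : 1 ≤ k) (hn : (n : ℝ) ≤ τ * k)
    (f : (l : Fin L) → (Fin k → U l) → (Fin n → X l) → ℝ) (hf : ∀ l, IsKernel (f l)) :
    ∀ ε : ℝ, 0 < ε → ε < 1 →
      (Filter.limsup (fun m : ℕ => Real.logb 2 (beta P Q Ch τ ε m) / m) Filter.atTop ≤
        - (klDiv (inducedDist P Ch k n f) (inducedDist Q Ch k n f) / k)) ∧
      (∀ k' : ℕ, 1 ≤ k' →
        Filter.limsup (fun m : ℕ => Real.logb 2 (beta P Q Ch τ ε m) / m) Filter.atTop ≤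
          - thetaK P Q Ch τ k') := by
  intro ε hε hε1
  refine ⟨limsup_logb_beta_le hP hQ hQpos hCh hτ hk hn hf hε hε1, fun k' hk' => ?_⟩
  refine le_neg_of_le_neg (csSup_le ?_ ?_)
  · obtain ⟨f₀, hf₀⟩ := exists_isKernel_zero U X k'
    exact ⟨_, 0, by push_cast; positivity, f₀, hf₀, rfl⟩
  · rintro _ ⟨n', hn', f', hf', rfl⟩
    exact le_neg_of_le_neg (limsup_logb_beta_le hP hQ hQpos hCh hτ hk' hn' hf' hε hε1)
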